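/- Let a : ℕ → ℝ with a_n > 0 for all n, let b be identically zero, and suppose the maximal Jacobi operator J = J(a,0) is proper. Let z ∈ ℂ \ ℝ and let R : ℓ²(ℕ₀) → ℓ²(ℕ₀) be a continuous linear map with R x ∈ D(J*J) and J*J(Rx) − z·Rx = x for all x, and R(J*Ju − zu) = u for all u ∈ D(J*J). Then ⟨δ₀, J(Rδ₀)⟩ = 0. -/

import Mathlib

open scoped InnerProductSpace ComplexConjugate

noncomputable section

/-- The Hilbert space `ℓ²(ℕ₀)` of square-summable complex sequences. -/
abbrev H : Type := lp (fun _ : ℕ => ℂ) 2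

/-- The formal Jacobi action: `(Ju)ₙ = aₙ₋₁uₙ₋₁ + bₙuₙ + aₙuₙ₊₁` (with `u₋₁ = 0`). -/
def jacobiAct (a : ℕ → ℝ) (b : ℕ → ℂ) (u : ℕ → ℂ) : ℕ → ℂ := fun n =>
  (if n = 0 then 0 else (a (n - 1) : ℂ) * u (n - 1)) + b n * u n + (a n : ℂ) * u (n + 1)

lemma jacobiAct_add (a : ℕ → ℝ) (b : ℕ → ℂ) (u v : ℕ → ℂ) :
    jacobiAct a b (u + v) = jacobiAct a b u + jacobiAct a b v := by
  funext n
  by_cases h : n = 0 <;> simp [jacobiAct, h] <;> ring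

lemma jacobiAct_smul (a : ℕ → ℝ) (b : ℕ → ℂ) (c : ℂ) (u : ℕ → ℂ) :
    jacobiAct a b (c • u) = c • jacobiAct a b u := by
  funext n
  by_cases h : n = 0 <;> simp [jacobiAct, h] <;> ring

lemma jacobiAct_zero (a : ℕ → ℝ) (b : ℕ → ℂ) : jacobiAct a b 0 = 0 := by
  funext n
  by_cases h : n = 0 <;> simp [jacobiAct, h]

/-- The domain of the maximal Jacobi operator: all `u ∈ ℓ²` whose formal Jacobi action is
again in `ℓ²`. -/
def jacobiDomain (a : ℕ → ℝ) (b : ℕ → ℂ) : Submodule ℂ H where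
  carrier := {u : H | Memℓp (jacobiAct a b ⇑u) 2}
  zero_mem' := by
    have h : Memℓp (E := fun _ : ℕ => ℂ) (jacobiAct a b 0) 2 := by
      rw [jacobiAct_zero]
      exact zero_memℓp (E := fun _ : ℕ => ℂ) (p := 2)
    exact h
  add_mem' := by
    intro u v hu hv
    have h : Memℓp (E := fun _ : ℕ => ℂ) (jacobiAct a b (⇑u + ⇑v)) 2 := by
      rw [jacobiAct_add]
      exact hu.add hv
    exact h
  smul_mem' := by
    intro c u hu
    simpa [lp.coeFn_smul, jacobiAct_smul] using hu.const_smul c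

/-- The maximal Jacobi operator `J(a,b)`, as a partially defined linear operator on
`ℓ²(ℕ₀)`. -/
def jacobiOp (a : ℕ → ℝ) (b : ℕ → ℂ) : H →ₗ.[ℂ] H where
  domain := jacobiDomain a b
  toFun :=
    { toFun := fun u => (⟨jacobiAct a b ⇑(u : H), u.2⟩ : H)
      map_add' := by
        intro u v
        apply Subtype.ext
        exact jacobiAct_add a b _ _
      map_smul' := by
        intro c u
        apply Subtype.ext
        exact jacobiAct_smul a b c _ }

/-- The subspace `ℓ²_c(ℕ₀)` of finitely supported sequences. -/
def finSupp : Submodule ℂ H where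
  carrier := {u : H | (Function.support ⇑u).Finite}
  zero_mem' := by simp [Function.support]
  add_mem' := by
    intro u v hu hv
    refine Set.Finite.subset (hu.union hv) ?_
    intro n hn
    simp only [Function.mem_support, lp.coeFn_add, Pi.add_apply] at hn
    by_contra hc
    simp only [Set.mem_union, Function.mem_support, not_or, not_not] at hc
    exact hn (by rw [hc.1, hc.2, add_zero])
  smul_mem' := by
    intro c u hu
    refine Set.Finite.subset hu ?_
    intro n hn
    simp only [Function.mem_support, lp.coeFn_smul, Pi.smul_apply, smul_eq_mul] at hn
    simp only [Function.mem_support]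
    intro h
    exact hn (by rw [h, mul_zero])

lemma finSupp_memℓp (a : ℕ → ℝ) (b : ℕ → ℂ) (u : ℕ → ℂ)
    (hu : (Function.support u).Finite) : Memℓp (jacobiAct a b u) 2 := by
  have hfin : (((· + 1) '' Function.support u ∪ Function.support u) ∪
      ((· - 1) '' Function.support u)).Finite :=
    ((hu.image _).union hu).union (hu.image _)
  refine (memℓp_zero (hfin.subset ?_)).of_exponent_ge zero_le
  intro n hn
  simp only [Set.mem_setOf_eq, jacobiAct] at hn
  by_contra hc
  simp only [Set.mem_union, Set.mem_image, Function.mem_support, not_or, not_exists,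
    not_and] at hc
  obtain ⟨⟨h1, h2⟩, h3⟩ := hc
  have e2 : u n = 0 := not_not.1 h2
  have e3 : u (n + 1) = 0 := by
    by_contra hne
    exact h3 (n + 1) hne (by omega)
  apply hn
  by_cases h : n = 0
  · subst h; simp [e2, show u 1 = 0 from e3]
  · have e1 : u (n - 1) = 0 := by
      by_contra hne
      exact h1 (n - 1) hne (by omega)
    simp [h, e1, e2, e3]

/-- The minimal Jacobi operator `J₀(a,b)`: the restriction of the maximal operator to the
finitely supported sequences. -/
def jacobiOp₀ (a : ℕ → ℝ) (b : ℕ → ℂ) : H →ₗ.[ℂ] H where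
  domain := finSupp
  toFun :=
    { toFun := fun u => (⟨jacobiAct a b ⇑(u : H), finSupp_memℓp a b _ u.2⟩ : H)
      map_add' := by
        intro u v
        apply Subtype.ext
        exact jacobiAct_add a b _ _
      map_smul' := by
        intro c u
        apply Subtype.ext
        exact jacobiAct_smul a b c _ }

/-- The Wronskian `Wₙ(u,v) = aₙ(uₙ₊₁vₙ − uₙvₙ₊₁)`. -/
def wronskian (a : ℕ → ℝ) (u v : ℕ → ℂ) (n : ℕ) : ℂ :=
  (a n : ℂ) * (u (n + 1) * v n - u n * v (n + 1))


lemma memℓp_two_of_norm_eq {f g : ℕ → ℂ} (hg : Memℓp g 2) (h : ∀ n, ‖f n‖ = ‖g n‖) :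
    Memℓp f 2 := by
  rw [memℓp_gen_iff (by norm_num)] at hg ⊢
  simpa only [h] using hg

/-- The diagonal unitary `Ω` with entries `(-1)ⁿ`. -/
def parity (u : H) : H :=
  ⟨fun n => (-1 : ℂ) ^ n * u n, memℓp_two_of_norm_eq (lp.memℓp u) fun n => by simp⟩

lemma parity_apply (u : H) (n : ℕ) : parity u n = (-1 : ℂ) ^ n * u n := rfl

lemma inner_parity_left (u v : H) : ⟪parity u, v⟫_ℂ = ⟪u, parity v⟫_ℂ := by
  rw [lp.inner_eq_tsum, lp.inner_eq_tsum]
  refine tsum_congr fun n => ?_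
  simp [parity_apply, RCLike.inner_apply]
  ring

/-- The free Jacobi action anticommutes with `Ω`. -/
lemma jacobiAct_parity (a : ℕ → ℝ) (u : H) (n : ℕ) :
    jacobiAct a 0 (parity u) n = -((-1 : ℂ) ^ n * jacobiAct a 0 u n) := by
  cases n with
  | zero => simp [jacobiAct, parity_apply]
  | succ n => simp [jacobiAct, parity_apply, pow_succ]; ring

lemma parity_mem_jacobiOp_domain (a : ℕ → ℝ) {u : H} (hu : u ∈ (jacobiOp a 0).domain) :
    parity u ∈ (jacobiOp a 0).domain := by
  have hu' : Memℓp (jacobiAct a 0 u) 2 := hu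
  have h : Memℓp (jacobiAct a 0 (parity u)) 2 :=
    memℓp_two_of_norm_eq hu' fun n => by simp [jacobiAct_parity]
  exact h

lemma jacobiOp_parity (a : ℕ → ℝ) {u : H} (hu : u ∈ (jacobiOp a 0).domain) :
    jacobiOp a 0 ⟨parity u, parity_mem_jacobiOp_domain a hu⟩ =
      -parity (jacobiOp a 0 ⟨u, hu⟩) := by
  refine lp.ext (funext fun n => ?_)
  exact jacobiAct_parity a u n

lemma single_mem_jacobiOp_domain (a : ℕ → ℝ) (b : ℕ → ℂ) (n : ℕ) (c : ℂ) :
    (lp.single 2 n c : H) ∈ (jacobiOp a b).domain := by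
  refine finSupp_memℓp a b _ ((Set.finite_singleton n).subset fun k hk => ?_)
  by_contra h
  exact hk (by simp [lp.single_apply, show k ≠ n from h])

lemma jacobiOp_domain_dense (a : ℕ → ℝ) (b : ℕ → ℂ) :
    Dense ((jacobiOp a b).domain : Set H) := by
  intro u
  refine mem_closure_of_tendsto (lp.hasSum_single (by norm_num) u) (.of_forall fun s => ?_)
  exact Submodule.sum_mem _ fun n _ => single_mem_jacobiOp_domain a b n _

lemma inner_adjoint_parity (a : ℕ → ℝ) {y : H} (hy : y ∈ (jacobiOp a 0).adjoint.domain)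
    (v : (jacobiOp a 0).domain) :
    ⟪-parity ((jacobiOp a 0).adjoint ⟨y, hy⟩), (v : H)⟫_ℂ = ⟪parity y, jacobiOp a 0 v⟫_ℂ := by
  have h := LinearPMap.adjoint_isFormalAdjoint (jacobiOp_domain_dense a 0) ⟨y, hy⟩
    ⟨parity v, parity_mem_jacobiOp_domain a v.2⟩
  rw [jacobiOp_parity a v.2] at h
  rw [inner_neg_left, inner_parity_left, inner_parity_left, h, inner_neg_right, neg_neg]

/-- **Vanishing of the off-diagonal Weyl entry for free Jacobi matrices** (used in
Theorem 2.8 (ii)): if `b ≡ 0` and `J = J(a,0)` is proper, then for the resolvent `R` of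
`J*J` at `z ∈ ℂ \ ℝ` one has `⟨δ₀, J(Rδ₀)⟩ = 0`. -/
theorem free_jacobi_offdiagonal_vanishes
    (a : ℕ → ℝ) (ha : ∀ n, 0 < a n)
    (hproper : (jacobiOp₀ a 0).closure = jacobiOp a 0)
    (z : ℂ) (hz : z.im ≠ 0) (R : H →L[ℂ] H)
    (hR1 : ∀ x : H, ∃ (h1 : R x ∈ (jacobiOp a 0).domain)
        (h2 : jacobiOp a 0 ⟨R x, h1⟩ ∈ (jacobiOp a 0).adjoint.domain),
      (jacobiOp a 0).adjoint ⟨jacobiOp a 0 ⟨R x, h1⟩, h2⟩ - z • R x = x)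
    (hR2 : ∀ (u : H) (h1 : u ∈ (jacobiOp a 0).domain)
        (h2 : jacobiOp a 0 ⟨u, h1⟩ ∈ (jacobiOp a 0).adjoint.domain),
      R ((jacobiOp a 0).adjoint ⟨jacobiOp a 0 ⟨u, h1⟩, h2⟩ - z • u) = u) :
    ∃ h1 : R (lp.single 2 0 (1 : ℂ)) ∈ (jacobiOp a 0).domain,
      ⟪lp.single 2 0 (1 : ℂ), jacobiOp a 0 ⟨R (lp.single 2 0 (1 : ℂ)), h1⟩⟫_ℂ = 0 := by
  set δ : H := lp.single 2 0 (1 : ℂ) with hδ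
  obtain ⟨h1, h2, heq⟩ := hR1 δ
  have hΩJ : parity (jacobiOp a 0 ⟨R δ, h1⟩) ∈ (jacobiOp a 0).adjoint.domain :=
    LinearPMap.mem_adjoint_domain_of_exists _ ⟨_, inner_adjoint_parity a h2⟩
  have hΩ : jacobiOp a 0 ⟨parity (R δ), parity_mem_jacobiOp_domain a h1⟩ ∈
      (jacobiOp a 0).adjoint.domain := by
    rw [jacobiOp_parity a h1]
    exact Submodule.neg_mem _ hΩJ
  have hval : (jacobiOp a 0).adjoint ⟨_, hΩ⟩ =
      parity ((jacobiOp a 0).adjoint ⟨jacobiOp a 0 ⟨R δ, h1⟩, h2⟩) := by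
    refine LinearPMap.adjoint_apply_eq (jacobiOp_domain_dense a 0) _ fun v => ?_
    have h := inner_adjoint_parity a h2 v
    rw [inner_neg_left] at h
    change _ = ⟪jacobiOp a 0 ⟨parity (R δ), parity_mem_jacobiOp_domain a h1⟩, _⟫_ℂ
    rw [jacobiOp_parity a h1, inner_neg_left, ← h, neg_neg]
  have hfix : parity (R δ) = R δ := by
    have h := hR2 _ (parity_mem_jacobiOp_domain a h1) hΩ
    rw [hval] at h
    rw [← h]
    congr 1
    ext n
    have hn := congrArg (fun x : H => x n) heq
    simp only [lp.coeFn_sub, lp.coeFn_smul, Pi.sub_apply, Pi.smul_apply, smul_eq_mul,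
      parity_apply] at hn ⊢
    have hδn : (-1 : ℂ) ^ n * δ n = δ n := by
      rcases eq_or_ne n 0 with rfl | h0
      · simp
      · simp [hδ, lp.single_apply, h0]
    linear_combination (-1 : ℂ) ^ n * hn + hδn
  have hone : R δ 1 = 0 := by
    have h := congrArg (fun x : H => x 1) hfix
    simp only [parity_apply] at h
    linear_combination (-1 / 2 : ℂ) * h
  refine ⟨h1, ?_⟩
  have hzero : (jacobiOp a 0 ⟨R δ, h1⟩ : H) 0 = 0 := by
    change jacobiAct a 0 (R δ) 0 = 0
    simp [jacobiAct, hone]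
  refine (lp.inner_single_left (𝕜 := ℂ) 0 (1 : ℂ) (jacobiOp a 0 ⟨R δ, h1⟩ : H)).trans ?_
  rw [hzero, inner_zero_right]

end
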